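/- Fix integers p, q ≥ 1 and set n = p + q + 1. In the braid group B_{n+2}, let X = σ_{[1,p+1]} σ_1 and Y = σ_{[p+2,n+1]} σ_{p+2}. Then for every integer k ≥ 0, Y X^k Y^{-1} = (σ_{p+3} σ_{p+2}) X^k (σ_{p+3} σ_{p+2})^{-1}. -/

import Mathlib

/-- The braid relations on `m - 1` generators: `PresentedGroup (braidRels m)` is the braid
group `B_m`.  The generator `i : Fin (m - 1)` corresponds to the standard generator
`σ_{i+1}` (in the usual 1-based numbering `σ_1, …, σ_{m-1}`). -/
def braidRels (m : ℕ) : Set (FreeGroup (Fin (m - 1))) :=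
  {r | (∃ i j : Fin (m - 1), (i : ℕ) + 1 = (j : ℕ) ∧
          r = FreeGroup.of i * FreeGroup.of j * FreeGroup.of i *
              (FreeGroup.of j * FreeGroup.of i * FreeGroup.of j)⁻¹) ∨
       (∃ i j : Fin (m - 1), (i : ℕ) + 2 ≤ (j : ℕ) ∧
          r = FreeGroup.of i * FreeGroup.of j * (FreeGroup.of j * FreeGroup.of i)⁻¹)}

/-- The braid group on `m` strands, presented by generators `σ_1, …, σ_{m-1}` with the braid
relations. -/
def BraidGroup (m : ℕ) : Type := PresentedGroup (braidRels m)

instance (m : ℕ) : Group (BraidGroup m) := by unfold BraidGroup; infer_instance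

/-- The standard generator `σ_j` of `B_m`, for `1 ≤ j ≤ m - 1` (and junk value `1` otherwise). -/
def σ (m j : ℕ) : BraidGroup m :=
  if h : 1 ≤ j ∧ j ≤ m - 1 then PresentedGroup.of ⟨j - 1, by omega⟩ else 1

/-- `σ_{[i,j]} = σ_i σ_{i+1} ⋯ σ_j` if `i ≤ j`, and `1` if `i > j`. -/
def σI (m i j : ℕ) : BraidGroup m := ((List.range' i (j + 1 - i)).map (σ m)).prod

/-- `σ̄_{[i,j]} = σ_j σ_{j-1} ⋯ σ_i` if `i ≤ j`, and `1` if `i > j`. -/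
def σIrev (m i j : ℕ) : BraidGroup m := ((List.range' i (j + 1 - i)).reverse.map (σ m)).prod

/-- The Dehn twist braid `twist_k = (σ_{[1,k-1]} σ_1)^{k-1}`. -/
def twist (m k : ℕ) : BraidGroup m := (σI m 1 (k - 1) * σ m 1) ^ (k - 1)

/-- The point-push braid `push_k = σ̄_{[1,k-1]} σ_{[1,k-1]}`. -/
def push (m k : ℕ) : BraidGroup m := σIrev m 1 (k - 1) * σI m 1 (k - 1)

theorem sigma_pos (m j : ℕ) (h : 1 ≤ j ∧ j ≤ m - 1) (h' : j - 1 < m - 1) :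
    σ m j = (PresentedGroup.of (rels := braidRels m) ⟨j - 1, h'⟩ : PresentedGroup (braidRels m)) :=
  dif_pos h

theorem sigma_neg (m j : ℕ) (h : ¬ (1 ≤ j ∧ j ≤ m - 1)) : σ m j = 1 :=
  dif_neg h

theorem sigma_comm (m i j : ℕ) (h : i + 2 ≤ j) : Commute (σ m i) (σ m j) := by
  by_cases h1 : 1 ≤ i ∧ i ≤ m - 1
  · by_cases h2 : 1 ≤ j ∧ j ≤ m - 1
    · have := PresentedGroup.one_of_mem (rels := braidRels m)
        (Or.inr ⟨⟨i - 1, by omega⟩, ⟨j - 1, by omega⟩, by simp only; omega, rfl⟩)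
      rw [map_mul, map_inv, mul_inv_eq_one, map_mul, map_mul] at this
      rw [sigma_pos m i h1 (by omega), sigma_pos m j h2 (by omega)]
      exact this
    · rw [sigma_neg m j h2]
      exact Commute.one_right _
  · rw [sigma_neg m i h1]
    exact Commute.one_left _

theorem sigma_braid (m i : ℕ) (h1 : 1 ≤ i) (h2 : i + 1 ≤ m - 1) :
    σ m i * σ m (i + 1) * σ m i = σ m (i + 1) * σ m i * σ m (i + 1) := by
  rw [sigma_pos m i (by omega) (by omega), sigma_pos m (i + 1) (by omega) (by omega)]
  have := PresentedGroup.one_of_mem (rels := braidRels m)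
      (Or.inl ⟨⟨i - 1, by omega⟩, ⟨i + 1 - 1, by omega⟩, by simp only; omega, rfl⟩)
  rw [map_mul, map_inv, mul_inv_eq_one, map_mul, map_mul, map_mul, map_mul] at this
  exact this

theorem sigmaI_comm (m a b : ℕ) (g : BraidGroup m)
    (h : ∀ i, a ≤ i → i ≤ b → Commute g (σ m i)) : Commute g (σI m a b) := by
  unfold σI
  apply Commute.list_prod_right
  intro x hx
  obtain ⟨i, hi, rfl⟩ := List.mem_map.1 hx
  rw [List.mem_range'_1] at hi
  exact h i (by omega) (by omega)

theorem sigmaI_cons (m a b : ℕ) (h : a ≤ b) : σI m a b = σ m a * σI m (a + 1) b := by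
  unfold σI
  rw [show b + 1 - a = (b + 1 - (a + 1)) + 1 by omega, List.range'_succ, List.map_cons,
    List.prod_cons]

/-- For `p, q ≥ 1`, `n = p + q + 1`, in `B_{n+2}` with
`X = σ_{[1,p+1]} σ_1` and `Y = σ_{[p+2,n+1]} σ_{p+2}`, for every integer `k ≥ 0` we have
`Y X^k Y⁻¹ = (σ_{p+3} σ_{p+2}) X^k (σ_{p+3} σ_{p+2})⁻¹`. -/
theorem Y_conjugation_of_X_pow (p q : ℕ) (hp : 1 ≤ p) (hq : 1 ≤ q) (n : ℕ)
    (hn : n = p + q + 1) (X Y : BraidGroup (n + 2))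
    (hX : X = σI (n + 2) 1 (p + 1) * σ (n + 2) 1)
    (hY : Y = σI (n + 2) (p + 2) (n + 1) * σ (n + 2) (p + 2)) :
    ∀ k : ℕ, Y * X ^ k * Y⁻¹ =
      (σ (n + 2) (p + 3) * σ (n + 2) (p + 2)) * X ^ k *
        (σ (n + 2) (p + 3) * σ (n + 2) (p + 2))⁻¹ := by
  intro k
  have hXc : ∀ j, p + 3 ≤ j → Commute (σ (n + 2) j) X := by
    intro j hj
    rw [hX]
    exact (sigmaI_comm _ _ _ _ fun i _ hi => (sigma_comm _ i j (by omega)).symm).mul_right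
      (sigma_comm _ 1 j (by omega)).symm
  have hR : Commute X (σI (n + 2) (p + 4) (n + 1)) :=
    sigmaI_comm _ _ _ _ fun i hi _ => (hXc i (by omega)).symm
  have hR2 : Commute (σ (n + 2) (p + 2)) (σI (n + 2) (p + 4) (n + 1)) :=
    sigmaI_comm _ _ _ _ fun i hi _ => sigma_comm _ _ i (by omega)
  have hb := sigma_braid (n + 2) (p + 2) (by omega) (by omega)
  rw [sigmaI_cons _ _ _ (by omega), sigmaI_cons _ _ _ (by omega)] at hY
  simp only [show p + 2 + 1 = p + 3 from rfl, show p + 3 + 1 = p + 4 from rfl] at hY hb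
  have h3 := hXc (p + 3) le_rfl
  generalize σI (n + 2) (p + 4) (n + 1) = R at *
  generalize σ (n + 2) (p + 2) = a at *
  generalize σ (n + 2) (p + 3) = b at *
  have hY' : Y = b * a * (b * R) := by
    rw [hY, mul_assoc, mul_assoc, ← hR2.eq, ← mul_assoc, ← mul_assoc, hb]
    simp only [mul_assoc]
  have hc : Commute (b * R) (X ^ k) := (h3.mul_left hR.symm).pow_right k
  rw [hY', mul_assoc (b * a), hc.eq]
  group
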